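/- If α lies in the complex upper half-plane ℍ and is imaginary quadratic, i.e. [ℚ(α):ℚ] = 2, then the singular value j(α) is an algebraic integer. -/

import Mathlib

open Polynomial Complex IntermediateField

noncomputable section

/-- 2×2 integer matrices. -/
abbrev Mat : Type := Matrix (Fin 2) (Fin 2) ℤ

/-- The modular group SL₂(ℤ). -/
abbrev SL2Z := Matrix.SpecialLinearGroup (Fin 2) ℤ

/-- A 2×2 integer matrix is primitive if the gcd of its four entries is 1. -/
def Mat.IsPrimitive (S : Mat) : Prop :=
  Nat.gcd (Nat.gcd (S 0 0).natAbs (S 0 1).natAbs)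
    (Nat.gcd (S 1 0).natAbs (S 1 1).natAbs) = 1

/-- Left equivalence of matrices under SL₂(ℤ). -/
def LeftEquiv (S T : Mat) : Prop := ∃ M : SL2Z, S = (M : Mat) * T

/-- Möbius action of an integer matrix on a complex number. -/
def moeb (S : Mat) (z : ℂ) : ℂ :=
  ((S 0 0 : ℂ) * z + (S 0 1 : ℂ)) / ((S 1 0 : ℂ) * z + (S 1 1 : ℂ))

/-- ψ(s) = s·∏_{p∣s}(1+1/p) = Σ_{d∣s squarefree} s/d. -/
def psi (s : ℕ) : ℕ := ∑ d ∈ s.divisors, if Squarefree d then s / d else 0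

/-- Eisenstein series g₂. -/
def g2C (z : ℂ) : ℂ :=
  60 * ∑' w : {v : ℤ × ℤ // v ≠ 0}, ((w.1.1 : ℂ) * z + (w.1.2 : ℂ)) ^ (-4 : ℤ)

/-- Eisenstein series g₃. -/
def g3C (z : ℂ) : ℂ :=
  140 * ∑' w : {v : ℤ × ℤ // v ≠ 0}, ((w.1.1 : ℂ) * z + (w.1.2 : ℂ)) ^ (-6 : ℤ)

/-- The discriminant Δ. -/
def discC (z : ℂ) : ℂ := g2C z ^ 3 - 27 * g3C z ^ 2

/-- The modular invariant j. -/
def jC (z : ℂ) : ℂ := 1728 * g2C z ^ 3 / discC z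

/-- A family of matrices is a complete system of representatives of the left SL₂(ℤ)-orbits
of primitive integer matrices of determinant `s`. -/
def IsOrbitReps (s : ℕ) {n : ℕ} (R : Fin n → Mat) : Prop :=
  (∀ ν, (R ν).IsPrimitive ∧ (R ν).det = (s : ℤ)) ∧
  ∀ T : Mat, T.IsPrimitive → T.det = (s : ℤ) → ∃! ν, LeftEquiv T (R ν)

/-- Evaluation of an integer polynomial at j(z). -/
def evalAtJ (z : ℂ) : Polynomial ℤ →+* ℂ := eval₂RingHom (Int.castRingHom ℂ) (jC z)

/-- J is the modular polynomial of level s: an element of ℤ[Y][X], monic in X of degree ψ(s),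
such that J(X, j(ω)) = ∏_ν (X − j(S_ν ω)) for every ω in the upper half-plane. -/
def IsModularPoly (s : ℕ) (J : Polynomial (Polynomial ℤ)) : Prop :=
  J.Monic ∧ J.natDegree = psi s ∧
  ∀ R : Fin (psi s) → Mat, IsOrbitReps s R → ∀ z : ℂ, 0 < z.im →
    J.map (evalAtJ z) = ∏ ν, (X - C (jC (moeb (R ν) z)))

/-- The one-variable polynomial J(X,X) obtained by setting Y = X. -/
def diagPoly (J : Polynomial (Polynomial ℤ)) : Polynomial ℤ := J.eval Polynomial.X

/-- φ_S(ω) = s¹²·Δ(Sω)/((cω+d)¹²·Δ(ω)). -/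
def phiS (S : Mat) (z : ℂ) : ℂ :=
  (S.det : ℂ) ^ 12 * discC (moeb S z) /
    (((S 1 0 : ℂ) * z + (S 1 1 : ℂ)) ^ 12 * discC z)

/-- K is an imaginary quadratic subfield of ℂ. -/
def IsImagQuad (K : Subfield ℂ) : Prop :=
  ∃ θ : ℂ, 0 < θ.im ∧ Module.finrank ℚ ℚ⟮θ⟯ = 2 ∧ K = ℚ⟮θ⟯.toSubfield

/-- O is an order of the field K: a subring of K which is a finitely generated additive
group containing a ℚ-basis of K. -/
structure IsOrder (K : Subfield ℂ) (O : Subring ℂ) : Prop where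
  le : (O : Set ℂ) ⊆ (K : Set ℂ)
  fg : O.toAddSubgroup.FG
  full : ∀ x ∈ K, ∃ n : ℤ, n ≠ 0 ∧ (n : ℂ) * x ∈ O

/-- The lattice spanned by a and b. -/
def zLat (a b : ℂ) : AddSubgroup ℂ := AddSubgroup.closure {a, b}

/-- (a,b) is a ℤ-basis (with Im(a/b) > 0) of a proper (characteristic) ideal of the
order O of K: the lattice ℤa+ℤb lies in K and its multiplier ring is exactly O. -/
def IsIdealBasis (K : Subfield ℂ) (O : Subring ℂ) (a b : ℂ) : Prop :=
  0 < (a / b).im ∧ a ∈ K ∧ b ∈ K ∧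
  ∀ lam : ℂ, lam ∈ O ↔ (lam * a ∈ zLat a b ∧ lam * b ∈ zLat a b)

/-- Two lattices differ by a nonzero scalar factor. -/
def LatEquiv (A B : AddSubgroup ℂ) : Prop :=
  ∃ μ : ℂ, μ ≠ 0 ∧ (B : Set ℂ) = (fun z => μ * z) '' (A : Set ℂ)

/-- The two ideals with the given bases lie in the same ideal class. -/
def IdealEquiv (a b a' b' : ℂ) : Prop := LatEquiv (zLat a b) (zLat a' b')

/-- Product of two lattices. -/
def latMul (A B : AddSubgroup ℂ) : AddSubgroup ℂ :=
  AddSubgroup.closure {z : ℂ | ∃ x ∈ A, ∃ y ∈ B, z = x * y}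

/-- μ is a primitive element of the order O : μ ∈ O and μ/t ∉ O for every integer t > 1. -/
def IsPrimElem (O : Subring ℂ) (μ : ℂ) : Prop :=
  μ ∈ O ∧ ∀ t : ℤ, 1 < t → μ / (t : ℂ) ∉ O

/-- μ and μ' are associated in O (differ by a unit of O). -/
def UnitAssoc (O : Subring ℂ) (μ μ' : ℂ) : Prop :=
  ∃ ε : ℂ, ε ∈ O ∧ ε ≠ 0 ∧ ε⁻¹ ∈ O ∧ μ' = ε * μ

/-- The ring of integers of a subfield K of ℂ, as a subring of ℂ. -/
def OK (K : Subfield ℂ) : Subring ℂ := (integralClosure ℤ ℂ).toSubring ⊓ K.toSubring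

/-- The index of an order O in the maximal order of K (for a quadratic field this
equals the conductor f of O). -/
def condIndex (K : Subfield ℂ) (O : Subring ℂ) : ℕ :=
  (O.toAddSubgroup.addSubgroupOf (OK K).toAddSubgroup).index

/-- The lattice in ℂ attached to an ideal of the maximal order of K. -/
def idealLat (K : Subfield ℂ) (I : Ideal ↥(OK K)) : AddSubgroup ℂ :=
  AddSubgroup.closure {z : ℂ | ∃ x ∈ I, (x : ℂ) = z}

/-- The lattice attached to the O-ideal I ∩ O, for an ideal I of the maximal order. -/
def primeOrderLat (K : Subfield ℂ) (O : Subring ℂ) (I : Ideal ↥(OK K)) : AddSubgroup ℂ :=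
  AddSubgroup.closure {z : ℂ | z ∈ O ∧ ∃ x ∈ I, (x : ℂ) = z}

/-- The set of all class invariants j(k) of ideal classes of the order O. -/
def classInvSet (K : Subfield ℂ) (O : Subring ℂ) : Set ℂ :=
  {w : ℂ | ∃ a b : ℂ, IsIdealBasis K O a b ∧ w = jC (a / b)}

/-- The ring class field Ω_R : the subfield of ℂ generated by K together with all
class invariants of the order O. -/
def ringClassField (K : Subfield ℂ) (O : Subring ℂ) : Subfield ℂ :=
  Subfield.closure ((K : Set ℂ) ∪ classInvSet K O)

theorem le_ringClassField (K : Subfield ℂ) (O : Subring ℂ) : K ≤ ringClassField K O :=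
  fun _ hx => Subfield.subset_closure (Set.mem_union_left _ hx)

noncomputable instance rcfAlgebra (K : Subfield ℂ) (O : Subring ℂ) :
    Algebra ↥K ↥(ringClassField K O) :=
  (Subfield.inclusion (le_ringClassField K O)).toAlgebra

theorem OK_mono {K L : Subfield ℂ} (h : K ≤ L) : OK K ≤ OK L := by
  intro x hx
  rw [OK, Subring.mem_inf] at hx ⊢
  exact ⟨hx.1, h hx.2⟩

/-- 𝔭 splits completely in L/K: the extension of 𝔭 to the ring of integers of L is a
product of pairwise distinct primes, each of residue degree one over 𝔭. -/
def SplitsCompletely (K L : Subfield ℂ) (h : K ≤ L) (p : Ideal ↥(OK K)) : Prop :=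
  ∃ (g : ℕ) (Q : Fin g → Ideal ↥(OK L)),
    Function.Injective Q ∧ (∀ i, (Q i).IsPrime) ∧
    Ideal.map (Subring.inclusion (OK_mono h)) p = ∏ i, Q i ∧
    ∀ i, Nat.card (↥(OK L) ⧸ Q i) = Nat.card (↥(OK K) ⧸ p)

/-- L is a finite extension of ℚ (a number field) inside ℂ. -/
def FinDimOverQ (L : Subfield ℂ) : Prop :=
  ∃ t : Finset ℂ, (L : Set ℂ) ⊆ (Submodule.span ℚ (t : Set ℂ) : Submodule ℚ ℂ)

/-- Lattice Eisenstein sums Σ_{w∈L, w≠0} w^{-k}. -/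
def gkL (k : ℕ) (L : AddSubgroup ℂ) : ℂ :=
  ∑' w : {w : ℂ // w ∈ L ∧ w ≠ 0}, (w : ℂ) ^ (-(k : ℤ))

def g2L (L : AddSubgroup ℂ) : ℂ := 60 * gkL 4 L
def g3L (L : AddSubgroup ℂ) : ℂ := 140 * gkL 6 L
def discL (L : AddSubgroup ℂ) : ℂ := g2L L ^ 3 - 27 * g3L L ^ 2

/-- The Weierstrass ℘-function of a lattice. -/
def wpL (z : ℂ) (L : AddSubgroup ℂ) : ℂ :=
  z ^ (-2 : ℤ) + ∑' w : {w : ℂ // w ∈ L ∧ w ≠ 0},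
    ((z - (w : ℂ)) ^ (-2 : ℤ) - (w : ℂ) ^ (-2 : ℤ))

/-- The Weber function τ_R(z, 𝔴), where e is the number of units of R. -/
def weber (e : ℕ) (z : ℂ) (L : AddSubgroup ℂ) : ℂ :=
  if e = 4 then 2 ^ 8 * 3 ^ 4 * (g2L L ^ 2 / discL L) * wpL z L ^ 2
  else if e = 6 then -(2 ^ 9 * 3 ^ 6) * (g3L L / discL L) * wpL z L ^ 3
  else -(2 ^ 7 * 3 ^ 5) * (g2L L * g3L L / discL L) * wpL z L

/-- The number of units (roots of unity) in the ring of integers of K. -/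
def numRootsOfUnity (K : Subfield ℂ) : ℕ :=
  Nat.card {x : ℂ // x ∈ OK K ∧ ∃ n : ℕ, 0 < n ∧ x ^ n = 1}

/-- λ ≡ 1 mod* 𝔪 (multiplicative congruence): λ = β/γ with β, γ integral and prime
to 𝔪 and β ≡ γ mod 𝔪. -/
def MulCongOne (K : Subfield ℂ) (m : Ideal ↥(OK K)) (lam : ℂ) : Prop :=
  ∃ β γ : ↥(OK K), (γ : ℂ) ≠ 0 ∧ lam = (β : ℂ) / (γ : ℂ) ∧
    Ideal.span {β} ⊔ m = ⊤ ∧ Ideal.span {γ} ⊔ m = ⊤ ∧ β - γ ∈ m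

/-- The Dedekind eta function. -/
def dedekindEta (z : ℂ) : ℂ :=
  Complex.exp (Real.pi * Complex.I * z / 12) *
    ∏' n : ℕ, (1 - Complex.exp (2 * Real.pi * Complex.I * ((n : ℂ) + 1) * z))

/-- ζ₂₄ = e^{2πi/24}. -/
def zeta24 : ℂ := Complex.exp (2 * Real.pi * Complex.I / 24)

/-- The image of the basis (a,b) under an integer matrix. -/
def matBasis (P : Mat) (a b : ℂ) : ℂ × ℂ :=
  ((P 0 0 : ℂ) * a + (P 0 1 : ℂ) * b, (P 1 0 : ℂ) * a + (P 1 1 : ℂ) * b)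

/-- The image of the basis (a,b) under a rational matrix. -/
def matBasisQ (B : Matrix (Fin 2) (Fin 2) ℚ) (a b : ℂ) : ℂ × ℂ :=
  ((B 0 0 : ℂ) * a + (B 0 1 : ℂ) * b, (B 1 0 : ℂ) * a + (B 1 1 : ℂ) * b)

/-- φ_B for a rational matrix B of positive determinant. -/
def phiQ (B : Matrix (Fin 2) (Fin 2) ℚ) (z : ℂ) : ℂ :=
  (B.det : ℂ) ^ 12 *
      discC (((B 0 0 : ℂ) * z + (B 0 1 : ℂ)) / ((B 1 0 : ℂ) * z + (B 1 1 : ℂ))) /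
    (((B 1 0 : ℂ) * z + (B 1 1 : ℂ)) ^ 12 * discC z)

/-- The lattice attached to the complex conjugate of an ideal of the maximal order. -/
def conjIdealLat (K : Subfield ℂ) (I : Ideal ↥(OK K)) : AddSubgroup ℂ :=
  AddSubgroup.closure {z : ℂ | ∃ x ∈ I, (starRingEnd ℂ) (x : ℂ) = z}

/-- The triangular representatives (a b; 0 d), a·d = s, gcd(a,b,d) = 1, 0 ≤ b < d,
encoded as triples (a, b, d). -/
def triReps (s : ℕ) : Finset (ℕ × ℕ × ℕ) :=
  (Finset.range (s + 1) ×ˢ Finset.range (s + 1) ×ˢ Finset.range (s + 1)).filter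
    (fun t => 0 < t.1 ∧ 0 < t.2.2 ∧ t.1 * t.2.2 = s ∧
      Nat.gcd t.1 (Nat.gcd t.2.1 t.2.2) = 1 ∧ t.2.1 < t.2.2)

section SingularValues

open UpperHalfPlane ModularForm Function.Periodic EisensteinSeries Filter Topology
open scoped MatrixGroups Manifold

local notation "𝕢" => Function.Periodic.qParam

/-- Power series with algebraic integer coefficients. -/
def integralPowerSeries : Subring (PowerSeries ℂ) :=
  (PowerSeries.map (algebraMap (integralClosure ℤ ℂ) ℂ)).range

lemma mem_integralPowerSeries_iff {p : PowerSeries ℂ} :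
    p ∈ integralPowerSeries ↔ ∀ n, IsIntegral ℤ (p.coeff n) := by
  constructor
  · rintro ⟨p, rfl⟩ n
    rw [PowerSeries.coeff_map]
    exact (p.coeff n).2
  · intro h
    exact ⟨PowerSeries.mk fun n => ⟨p.coeff n, h n⟩, by ext n; simp⟩

lemma isIntegral_natCast_complex (n : ℕ) : IsIntegral ℤ (n : ℂ) := by
  simpa using isIntegral_algebraMap (R := ℤ) (A := ℂ) (x := (n : ℤ))

lemma mem_integralPowerSeries_of_X_mul {p : PowerSeries ℂ}
    (h : PowerSeries.X * p ∈ integralPowerSeries) : p ∈ integralPowerSeries := by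
  rw [mem_integralPowerSeries_iff] at h ⊢
  intro n
  simpa using h (n + 1)

/-- Division by a power series with constant coefficient `1` preserves integrality. -/
lemma mem_integralPowerSeries_of_mul {p v : PowerSeries ℂ} (hv : v ∈ integralPowerSeries)
    (hv1 : PowerSeries.constantCoeff v = 1) (h : v * p ∈ integralPowerSeries) :
    p ∈ integralPowerSeries := by
  obtain ⟨v, rfl⟩ := hv
  have hv0 : PowerSeries.constantCoeff v = 1 := by
    apply Subtype.val_injective
    rw [← PowerSeries.coeff_zero_eq_constantCoeff_apply, PowerSeries.coeff_map] at hv1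
    rw [← PowerSeries.coeff_zero_eq_constantCoeff_apply]
    exact hv1
  have hw : v * v.invOfUnit 1 = 1 := PowerSeries.mul_invOfUnit v 1 (by simpa using hv0)
  have : p = PowerSeries.map (algebraMap (integralClosure ℤ ℂ) ℂ) (v.invOfUnit 1) *
      (PowerSeries.map (algebraMap (integralClosure ℤ ℂ) ℂ) v * p) := by
    rw [← mul_assoc, ← map_mul, mul_comm _ v, hw, map_one, one_mul]
  rw [this]
  exact mul_mem ⟨_, rfl⟩ h

lemma isIntegral_coeff_of_series {p : PowerSeries ℂ} (a : ℕ → ℕ)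
    (h : p = PowerSeries.mk fun n => (a n : ℂ)) : p ∈ integralPowerSeries := by
  rw [mem_integralPowerSeries_iff, h]
  intro n
  simpa using isIntegral_natCast_complex (a n)

/-- The power series with coefficients `σ_k(n)`, `n ≥ 1`. -/
def sigmaSeries (k : ℕ) : PowerSeries ℂ :=
  PowerSeries.mk fun n => (ArithmeticFunction.sigma k n : ℂ)

lemma sigmaSeries_mem (k : ℕ) : sigmaSeries k ∈ integralPowerSeries :=
  isIntegral_coeff_of_series _ rfl

lemma qExpansion_E₄ : qExpansion 1 E₄ = 1 + 240 * sigmaSeries 3 := by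
  ext n
  rw [E_qExpansion_coeff _ ⟨2, rfl⟩]
  have : (240 : PowerSeries ℂ) = PowerSeries.C 240 := (map_ofNat PowerSeries.C 240).symm
  rw [map_add, this, PowerSeries.coeff_C_mul, sigmaSeries, PowerSeries.coeff_mk,
    PowerSeries.coeff_one]
  rcases eq_or_ne n 0 with rfl | hn
  · simp
  · norm_num [hn, show _root_.bernoulli 4 = -1 / 30 by decide +kernel]

lemma qExpansion_E₆ : qExpansion 1 E₆ = 1 - 504 * sigmaSeries 5 := by
  ext n
  rw [E_qExpansion_coeff _ ⟨3, rfl⟩]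
  have : (504 : PowerSeries ℂ) = PowerSeries.C 504 := (map_ofNat PowerSeries.C 504).symm
  rw [map_sub, this, PowerSeries.coeff_C_mul, sigmaSeries, PowerSeries.coeff_mk,
    PowerSeries.coeff_one]
  rcases eq_or_ne n 0 with rfl | hn
  · simp
  · norm_num [hn, show _root_.bernoulli 6 = 1 / 42 by decide +kernel]

lemma qExpansion_E₄_mem : qExpansion 1 E₄ ∈ integralPowerSeries := by
  rw [qExpansion_E₄]
  exact add_mem (one_mem _) (mul_mem (ofNat_mem _ 240) (sigmaSeries_mem 3))

lemma twelve_dvd_five_mul_sigma_add (n : ℕ) :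
    12 ∣ 5 * ArithmeticFunction.sigma 3 n + 7 * ArithmeticFunction.sigma 5 n := by
  rw [ArithmeticFunction.sigma_apply, ArithmeticFunction.sigma_apply, Finset.mul_sum,
    Finset.mul_sum, ← Finset.sum_add_distrib]
  refine Finset.dvd_sum fun d _ => ?_
  rw [Nat.dvd_iff_mod_eq_zero, Nat.add_mod, Nat.mul_mod, Nat.pow_mod, Nat.mul_mod 7,
    Nat.pow_mod d 5]
  have : d % 12 < 12 := Nat.mod_lt _ (by norm_num)
  interval_cases d % 12 <;> rfl

lemma qExpansion_discriminant_mem : qExpansion 1 discriminant ∈ integralPowerSeries := by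
  have h1 : (1728 : ℂ) • qExpansion 1 discriminant =
      qExpansion 1 E₄ ^ 3 - qExpansion 1 E₆ ^ 2 := by
    have h : ((1728 : ℂ) • ⇑CuspForm.discriminant) =
        ⇑(ModularForm.mcast (by decide) (E₄.pow 3) - ModularForm.mcast (by decide) (E₆.pow 2) :
          ModularForm 𝒮ℒ 12) := by
      ext z
      change (1728 : ℂ) * discriminant z = E₄ z ^ 3 - E₆ z ^ 2
      grind [discriminant_eq_E₄_cube_sub_E₆_sq z]
    have h' := congrArg (qExpansion 1) h
    rw [ModularForm.qExpansion_smul one_pos one_mem_strictPeriods_SL (1728)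
      CuspForm.discriminant] at h'
    rw [FunLike.coe_sub, ModularForm.qExpansion_sub one_pos one_mem_strictPeriods_SL] at h'
    simp only [coe_mcast, ModularForm.qExpansion_pow one_pos one_mem_strictPeriods_SL] at h'
    exact h'
  have h2 : (1728 : ℂ) • qExpansion 1 discriminant = (1728 : ℂ) •
      (PowerSeries.mk (fun n => (((5 * ArithmeticFunction.sigma 3 n +
        7 * ArithmeticFunction.sigma 5 n) / 12 : ℕ) : ℂ)) + 100 * sigmaSeries 3 ^ 2 +
        8000 * sigmaSeries 3 ^ 3 - 147 * sigmaSeries 5 ^ 2) := by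
    have h3 : (5 * sigmaSeries 3 + 7 * sigmaSeries 5) = 12 *
       PowerSeries.mk (fun n => (((5 * ArithmeticFunction.sigma 3 n +
        7 * ArithmeticFunction.sigma 5 n) / 12 : ℕ) : ℂ)) := by
      ext n
      have e (m : ℕ) [m.AtLeastTwo] : (OfNat.ofNat m : PowerSeries ℂ) =
        PowerSeries.C (OfNat.ofNat m) := (map_ofNat PowerSeries.C m).symm
      rw [map_add, e 5, e 7, e 12]
      simp only [PowerSeries.coeff_C_mul, sigmaSeries, PowerSeries.coeff_mk]
      rw [Nat.cast_div (twelve_dvd_five_mul_sigma_add n) (by norm_num)]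
      push_cast
      ring
    rw [h1, qExpansion_E₄, qExpansion_E₆, PowerSeries.smul_eq_C_mul,
      show (PowerSeries.C (1728 : ℂ)) = 1728 from map_ofNat PowerSeries.C 1728]
    linear_combination 144 * h3
  rw [(smul_right_injective _ (show (1728 : ℂ) ≠ 0 by norm_num)) h2]
  have h4 := isIntegral_coeff_of_series (fun n => (5 * ArithmeticFunction.sigma 3 n +
        7 * ArithmeticFunction.sigma 5 n) / 12) rfl
  exact sub_mem (add_mem (add_mem h4 (mul_mem (ofNat_mem _ 100) (pow_mem (sigmaSeries_mem 3) 2)))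
    (mul_mem (ofNat_mem _ 8000) (pow_mem (sigmaSeries_mem 3) 3)))
    (mul_mem (ofNat_mem _ 147) (pow_mem (sigmaSeries_mem 5) 2))

/-- `Δ = q · v` with `v` an integral power series with constant coefficient `1`. -/
lemma exists_qExpansion_discriminant_eq_X_mul : ∃ v ∈ integralPowerSeries,
    PowerSeries.constantCoeff v = 1 ∧ qExpansion 1 discriminant = PowerSeries.X * v := by
  have h0 : PowerSeries.constantCoeff (qExpansion 1 discriminant) = 0 := by
    simpa using CuspFormClass.qExpansion_coeff_zero CuspForm.discriminant one_pos
      one_mem_strictPeriods_SL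
  obtain ⟨v, hv⟩ := PowerSeries.X_dvd_iff.mpr h0
  refine ⟨v, mem_integralPowerSeries_of_X_mul (hv ▸ qExpansion_discriminant_mem), ?_, hv⟩
  have := discriminant_qExpansion_coeff_one
  rw [hv] at this
  simpa using this

/-- The modular invariant `j = E₄³ / Δ` on the upper half plane. -/
def jInvariant (τ : ℍ) : ℂ := E₄ τ ^ 3 / discriminant τ

lemma jInvariant_mul_discriminant (τ : ℍ) : jInvariant τ * discriminant τ = E₄ τ ^ 3 :=
  div_mul_cancel₀ _ (discriminant_ne_zero τ)

lemma constantCoeff_qExpansion_E₄ : PowerSeries.constantCoeff (qExpansion 1 E₄) = 1 := by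
  rw [← PowerSeries.coeff_zero_eq_constantCoeff_apply, E_qExpansion_coeff _ ⟨2, rfl⟩]
  simp

/-- A level one modular form of weight `12 N` with integral `q`-expansion is `Δ ^ N` times an
integral polynomial in `j` whose coefficient of degree `N` is the value at infinity. -/
lemma exists_polynomial_jInvariant (N : ℕ) {k : ℤ} (hk : k = 12 * N) (F : ModularForm 𝒮ℒ k)
    (hF : qExpansion 1 F ∈ integralPowerSeries) :
    ∃ P : (integralClosure ℤ ℂ)[X], P.natDegree ≤ N ∧
      (P.coeff N : ℂ) = (qExpansion 1 F).coeff 0 ∧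
      ∀ τ, F τ = aeval (jInvariant τ) P * discriminant τ ^ N := by
  induction N generalizing k with
  | zero =>
    obtain rfl : k = 0 := by simpa using hk
    obtain ⟨c, hc⟩ := ModularFormClass.levelOne_weight_zero_const F
    have h0 : c = (qExpansion 1 F).coeff 0 := by
      have := ModularFormClass.qExpansion_coeff_unique (c := fun m => if m = 0 then c else 0)
        one_pos one_mem_strictPeriods_SL (f := F) (fun τ => ?_) 0
      · simpa using this
      · convert hasSum_single (f := fun m => (if m = 0 then c else 0) • 𝕢 1 τ ^ m) 0 ?_
        · simp [hc]
        · intro m hm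
          simp [hm]
    have hi := mem_integralPowerSeries_iff.mp hF 0
    refine ⟨C ⟨_, hi⟩, by simp, by simp, fun τ => ?_⟩
    rw [aeval_C, pow_zero, mul_one]
    exact (congrFun hc τ).trans h0
  | succ N ih =>
    have hi := mem_integralPowerSeries_iff.mp hF 0
    set a := (qExpansion 1 F).coeff 0 with ha
    have hw : ((3 * (N + 1) : ℕ) : ℤ) * 4 = k := by rw [hk]; push_cast; ring
    set G : ModularForm 𝒮ℒ k := F - a • ModularForm.mcast hw (E₄.pow (3 * (N + 1))) with hG
    have hGq : qExpansion 1 G = qExpansion 1 F - PowerSeries.C a *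
        qExpansion 1 E₄ ^ (3 * (N + 1)) := by
      rw [hG, FunLike.coe_sub, ModularForm.qExpansion_sub one_pos one_mem_strictPeriods_SL,
        FunLike.coe_smul, ModularForm.qExpansion_smul one_pos one_mem_strictPeriods_SL,
        ModularForm.qExpansion_mcast, ModularForm.qExpansion_pow one_pos one_mem_strictPeriods_SL,
        PowerSeries.smul_eq_C_mul]
    have hCa : PowerSeries.C a ∈ integralPowerSeries := by
      rw [mem_integralPowerSeries_iff]
      intro n
      rw [PowerSeries.coeff_C]
      split_ifs
      exacts [hi, isIntegral_zero]
    have hGi : qExpansion 1 G ∈ integralPowerSeries := by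
      rw [hGq]
      exact sub_mem hF (mul_mem hCa (pow_mem qExpansion_E₄_mem _))
    have hG0 : (qExpansion 1 G).coeff 0 = 0 := by
      rw [hGq, map_sub, PowerSeries.coeff_C_mul, PowerSeries.coeff_zero_eq_constantCoeff_apply,
        PowerSeries.coeff_zero_eq_constantCoeff_apply, map_pow, constantCoeff_qExpansion_E₄, ha,
        PowerSeries.coeff_zero_eq_constantCoeff_apply]
      simp
    set H := CuspForm.discriminantEquiv (toCuspForm G hG0) with hH
    have hHi : qExpansion 1 H ∈ integralPowerSeries := by
      obtain ⟨v, hv, hv1, hΔ⟩ := exists_qExpansion_discriminant_eq_X_mul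
      rw [qExpansion_eq_qExpansion_discriminant_mul G hG0, hΔ, mul_assoc] at hGi
      exact mem_integralPowerSeries_of_mul hv hv1 (mem_integralPowerSeries_of_X_mul hGi)
    obtain ⟨P, hPd, -, hP⟩ := ih (by rw [hk]; push_cast; ring) H hHi
    refine ⟨C ⟨a, hi⟩ * X ^ (N + 1) + P, ?_, ?_, fun τ => ?_⟩
    · exact natDegree_add_le_of_degree_le (natDegree_C_mul_X_pow_le _ _) (hPd.trans N.le_succ)
    · rw [coeff_add, coeff_C_mul_X_pow, if_pos rfl,
        coeff_eq_zero_of_natDegree_lt (Nat.lt_succ_of_le hPd), add_zero]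
    · have h1 : discriminant τ * H τ = F τ - a * E₄ τ ^ (3 * (N + 1)) := by
        rw [hH, discriminant_mul_discriminantEquiv_apply]
        change (F τ - a * (E₄.pow (3 * (N + 1))) τ) = _
        rw [ModularForm.coe_pow]
        rfl
      have h2 : aeval (jInvariant τ) (C (⟨a, hi⟩ : integralClosure ℤ ℂ) * X ^ (N + 1) + P) =
          a * jInvariant τ ^ (N + 1) + aeval (jInvariant τ) P := by
        rw [map_add, map_mul, aeval_C, map_pow, aeval_X]
        rfl
      rw [h2]
      rw [hP, pow_mul, ← jInvariant_mul_discriminant] at h1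
      linear_combination -h1

/-- `q ^ r * f` is given by a power series in `q = exp (2πiτ / s)` with algebraic integer
coefficients and constant coefficient `u`. -/
def HasQExp (s : ℕ) (r : ℤ) (u : ℂ) (f : ℍ → ℂ) : Prop :=
  ∃ p ∈ integralPowerSeries, PowerSeries.constantCoeff p = u ∧
    ∀ τ : ℍ, HasSum (fun k => p.coeff k * 𝕢 s τ ^ k) (𝕢 s τ ^ r * f τ)

namespace HasQExp

variable {s : ℕ} {r r' : ℤ} {u u' : ℂ} {f g : ℍ → ℂ}

lemma mul (hf : HasQExp s r u f) (hg : HasQExp s r' u' g) :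
    HasQExp s (r + r') (u * u') (fun τ => f τ * g τ) := by
  obtain ⟨p, hp, rfl, hpf⟩ := hf
  obtain ⟨p', hp', rfl, hpg⟩ := hg
  refine ⟨p * p', mul_mem hp hp', map_mul _ _ _, fun τ => ?_⟩
  have h1 := (hpf τ).summable.norm
  have h2 := (hpg τ).summable.norm
  have h3 := (summable_norm_sum_mul_antidiagonal_of_summable_norm h1 h2).of_norm.hasSum
  rw [← tsum_mul_tsum_eq_tsum_sum_antidiagonal_of_summable_norm h1 h2, (hpf τ).tsum_eq,
    (hpg τ).tsum_eq] at h3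
  convert! h3 using 1
  · ext k
    rw [PowerSeries.coeff_mul, Finset.sum_mul]
    refine Finset.sum_congr rfl fun x hx => ?_
    rw [← Finset.HasAntidiagonal.mem_antidiagonal.mp hx, pow_add]
    ring
  · rw [zpow_add₀ (qParam_ne_zero _)]
    ring

lemma qPow (s n : ℕ) : HasQExp s n (if n = 0 then 1 else 0) (fun _ => 1) := by
  refine ⟨PowerSeries.X ^ n, ?_, ?_, fun τ => ?_⟩
  · rw [mem_integralPowerSeries_iff]
    intro k
    rw [PowerSeries.coeff_X_pow]
    split_ifs
    exacts [isIntegral_one, isIntegral_zero]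
  · rw [← PowerSeries.coeff_zero_eq_constantCoeff_apply, PowerSeries.coeff_X_pow]
    simp only [eq_comm]
  · convert! hasSum_single (f := fun k => (PowerSeries.X ^ n).coeff k * 𝕢 s τ ^ k) n ?_ using 1
    · simp [PowerSeries.coeff_X_pow]
    · intro k hk
      simp [PowerSeries.coeff_X_pow, hk]

lemma one (s : ℕ) : HasQExp s 0 1 (fun _ => 1) := by
  simpa using qPow s 0

lemma pow (hf : HasQExp s r u f) (n : ℕ) : HasQExp s (n * r) (u ^ n) (fun τ => f τ ^ n) := by
  induction n with
  | zero => simpa using one s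
  | succ n ih =>
    convert! ih.mul hf using 1
    push_cast
    ring

lemma prod {ι : Type*} (t : Finset ι) {r : ι → ℤ} {u : ι → ℂ} {f : ι → ℍ → ℂ}
    (h : ∀ i ∈ t, HasQExp s (r i) (u i) (f i)) :
    HasQExp s (∑ i ∈ t, r i) (∏ i ∈ t, u i) (fun τ => ∏ i ∈ t, f i τ) := by
  classical
  induction t using Finset.induction_on with
  | empty => simpa using one s
  | insert i t hi ih =>
    simp only [Finset.sum_insert hi, Finset.prod_insert hi]
    exact (h i (Finset.mem_insert_self i t)).mul
      (ih fun j hj => h j (Finset.mem_insert_of_mem hj))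

lemma sub (hf : HasQExp s r u f) (hg : HasQExp s r u' g) :
    HasQExp s r (u - u') (fun τ => f τ - g τ) := by
  obtain ⟨p, hp, rfl, hpf⟩ := hf
  obtain ⟨p', hp', rfl, hpg⟩ := hg
  refine ⟨p - p', sub_mem hp hp', map_sub _ _ _, fun τ => ?_⟩
  simpa [sub_mul, mul_sub] using (hpf τ).sub (hpg τ)

lemma of_lt (hf : HasQExp s r u f) (h : r < r') : HasQExp s r' 0 f := by
  have hn : (r' - r).toNat ≠ 0 := by lia
  have h1 := hf.mul (qPow s (r' - r).toNat)
  rw [if_neg hn, mul_zero] at h1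
  convert! h1 using 1
  · lia
  · simp

lemma sub_of_ne (hf : HasQExp s r u f) (hg : HasQExp s r' u' g) (h : r ≠ r') :
    HasQExp s (max r r') (if r' < r then u else -u') (fun τ => f τ - g τ) := by
  rcases h.lt_or_gt with h | h
  · rw [max_eq_right h.le, if_neg h.not_gt]
    simpa using (hf.of_lt h).sub hg
  · rw [max_eq_left h.le, if_pos h]
    simpa using hf.sub (hg.of_lt h)

lemma comp (hf : HasQExp 1 r u f) {ζ : ℂ} (hζ0 : ζ ≠ 0) (hζ : IsIntegral ℤ ζ)
    (hζr : IsIntegral ℤ (ζ ^ (-r))) {A : ℕ} (hA : A ≠ 0) {φ : ℍ → ℍ}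
    (hφ : ∀ τ : ℍ, 𝕢 1 (φ τ) = ζ * 𝕢 s τ ^ A) :
    HasQExp s (A * r) (ζ ^ (-r) * u) (fun τ => f (φ τ)) := by
  obtain ⟨p, hp, rfl, hpf⟩ := hf
  rw [mem_integralPowerSeries_iff] at hp
  refine ⟨PowerSeries.C (ζ ^ (-r)) * (PowerSeries.rescale ζ p).expand A hA, ?_, ?_, fun τ => ?_⟩
  · rw [mem_integralPowerSeries_iff]
    intro n
    rw [PowerSeries.coeff_C_mul, PowerSeries.coeff_expand]
    refine hζr.mul ?_
    split_ifs
    · rw [PowerSeries.coeff_rescale]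
      exact (hζ.pow _).mul (hp _)
    · exact isIntegral_zero
  · rw [map_mul, PowerSeries.constantCoeff_C, PowerSeries.constantCoeff_expand,
      ← PowerSeries.coeff_zero_eq_constantCoeff_apply, PowerSeries.coeff_rescale]
    simp
  · have h1 := (hpf (φ τ)).mul_left (ζ ^ (-r))
    simp only [Nat.cast_one, hφ] at h1
    rw [mul_zpow, ← mul_assoc, ← mul_assoc, ← zpow_add₀ hζ0, neg_add_cancel, zpow_zero,
      one_mul, ← zpow_natCast, ← zpow_mul] at h1
    refine ((mul_right_injective₀ hA).hasSum_iff fun n hn => ?_).mp (h1.congr_fun fun k => ?_)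
    · rw [PowerSeries.coeff_C_mul, PowerSeries.coeff_expand, if_neg, mul_zero, zero_mul]
      rintro ⟨k, rfl⟩
      exact hn ⟨k, rfl⟩
    · rw [Function.comp_apply, PowerSeries.coeff_C_mul, PowerSeries.coeff_expand_mul,
        PowerSeries.coeff_rescale, mul_pow, pow_mul, zpow_natCast]
      ring

end HasQExp

lemma hasQExp_discriminant : HasQExp 1 (-1) 1 discriminant := by
  obtain ⟨v, hv, hv1, hΔ⟩ := exists_qExpansion_discriminant_eq_X_mul
  refine ⟨v, hv, hv1, fun τ => ?_⟩
  have h1 := ModularForm.hasSum_qExpansion (f := CuspForm.discriminant) one_pos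
    one_mem_strictPeriods_SL τ
  rw [CuspForm.coe_discriminant, hΔ, ← hasSum_nat_add_iff' 1] at h1
  have h2 := h1.mul_left ((𝕢 1 τ)⁻¹)
  have h0 : 𝕢 1 τ ≠ 0 := qParam_ne_zero _
  convert! h2 using 1
  · ext k
    simp only [PowerSeries.coeff_succ_X_mul, Nat.cast_one]
    field_simp
    ring
  · simp

lemma hasQExp_E₄ : HasQExp 1 0 1 E₄ := by
  refine ⟨_, qExpansion_E₄_mem, constantCoeff_qExpansion_E₄, fun τ => ?_⟩
  simpa using ModularForm.hasSum_qExpansion (f := E₄) one_pos one_mem_strictPeriods_SL τ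

lemma mdifferentiable_qParam : MDiff (fun τ : ℍ => 𝕢 1 τ) := by
  rw [UpperHalfPlane.mdifferentiable_iff]
  refine DifferentiableOn.congr (f := fun z => 𝕢 1 z) ?_ fun z hz => ?_
  · exact (differentiable_qParam (h := 1)).differentiableOn
  · simp [ofComplex_apply_of_im_pos hz]

lemma mdifferentiable_jInvariant : MDiff jInvariant :=
  (E₄.holo'.pow 3).div CuspForm.discriminant.holo' discriminant_ne_zero

lemma hasQExp_jInvariant : HasQExp 1 1 1 jInvariant := by
  set g : ℍ → ℂ := fun τ => 𝕢 1 τ * jInvariant τ with hg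
  have hper : Function.Periodic (g ∘ ofComplex) (1 : ℝ) := by
    intro w
    have h1 := SlashInvariantFormClass.periodic_comp_ofComplex E₄ one_mem_strictPeriods_SL w
    have h2 := SlashInvariantFormClass.periodic_comp_ofComplex CuspForm.discriminant
      one_mem_strictPeriods_SL w
    simp only [Function.comp_apply, CuspForm.coe_discriminant] at h1 h2
    simp only [hg, Function.comp_apply, jInvariant, h1, h2]
    congr 1
    rcases lt_or_ge 0 w.im with hw | hw
    · rw [ofComplex_apply_of_im_pos hw, ofComplex_apply_of_im_pos (by simpa using hw)]
      simp [qParam, mul_add, Complex.exp_add]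
    · rw [ofComplex_apply_of_im_nonpos hw, ofComplex_apply_of_im_nonpos (by simpa using hw)]
  have hhol : MDiff g := mdifferentiable_qParam.mul mdifferentiable_jInvariant
  have hbdd : IsBoundedAtImInfty g := by
    have h1 : IsBoundedAtImInfty (fun τ : ℍ => 𝕢 1 τ / discriminant τ) := by
      rw [IsBoundedAtImInfty, BoundedAtFilter]
      refine (Asymptotics.div_isBoundedUnder_of_isBigO (.trans (.of_norm_left ?_)
        exp_isBigO_discriminant)).isBigO_one ℝ
      convert! Asymptotics.isBigO_refl _ _ using 1
      ext τ
      simp [norm_qParam]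
    have h2 : IsBoundedAtImInfty E₄ := ModularFormClass.bdd_at_infty E₄
    convert! h1.mul (h2.mul (h2.mul h2)) using 1
    ext τ
    simp only [hg, jInvariant, Pi.mul_apply]
    ring
  have hgan := UpperHalfPlane.analyticAt_cuspFunction_zero one_pos hper hhol hbdd
  have hΔan := ModularFormClass.analyticAt_cuspFunction_zero CuspForm.discriminant one_pos
    one_mem_strictPeriods_SL
  obtain ⟨v, hv, hv1, hΔ⟩ := exists_qExpansion_discriminant_eq_X_mul
  obtain ⟨p, hp, hp1, hpE⟩ := hasQExp_E₄.pow 3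
  have hmul := UpperHalfPlane.qExpansion_mul hgan hΔan
  have hX : PowerSeries.X * p = qExpansion 1 (g * CuspForm.discriminant) := by
    ext n
    refine UpperHalfPlane.qExpansion_coeff_unique (h := 1)
      (⟨g * CuspForm.discriminant, (hhol.mul CuspForm.discriminant.holo').continuous⟩ : C(ℍ, ℂ))
      (c := fun n => (PowerSeries.X * p).coeff n) one_pos ?_ (fun τ => ?_) n
    · rw [ContinuousMap.coe_mk, UpperHalfPlane.cuspFunction_mul hgan.continuousAt hΔan.continuousAt]
      exact hgan.mul hΔan
    · rw [← hasSum_nat_add_iff' 1]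
      convert! (hpE τ).mul_left (𝕢 1 τ) using 1
      · ext k
        simp only [PowerSeries.coeff_succ_X_mul, Nat.cast_one, smul_eq_mul]
        ring
      · simp [hg, ← jInvariant_mul_discriminant, mul_assoc]
  rw [hmul, CuspForm.coe_discriminant, hΔ, mul_left_comm] at hX
  have hX' := mul_left_cancel₀ PowerSeries.X_ne_zero hX
  rw [mul_comm] at hX'
  refine ⟨qExpansion 1 g, mem_integralPowerSeries_of_mul hv hv1 (hX' ▸ hp), ?_, fun τ => ?_⟩
  · rw [hX', map_mul, hv1] at hp1
    simpa using hp1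
  · simpa using UpperHalfPlane.hasSum_qExpansion one_pos hper hhol hbdd τ

lemma discriminant_smul (γ : SL(2, ℤ)) (τ : ℍ) :
    discriminant (γ • τ) = denom γ τ ^ (12 : ℤ) * discriminant τ :=
  SlashInvariantForm.slash_action_eqn' CuspForm.discriminant
    (show (γ : GL (Fin 2) ℝ) ∈ 𝒮ℒ from ⟨γ, rfl⟩) τ

lemma jInvariant_smul (γ : SL(2, ℤ)) (τ : ℍ) : jInvariant (γ • τ) = jInvariant τ := by
  have h : E₄ (γ • τ) = denom γ τ ^ (4 : ℤ) * E₄ τ :=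
    SlashInvariantForm.slash_action_eqn' E₄ (show (γ : GL (Fin 2) ℝ) ∈ 𝒮ℒ from ⟨γ, rfl⟩) τ
  have h0 : denom γ τ ≠ 0 := denom_ne_zero _ τ
  have h1 := discriminant_ne_zero τ
  rw [jInvariant, jInvariant, h, discriminant_smul]
  field_simp

namespace FixedDetMatrix

variable {s : ℕ}

/-- Right multiplication by an element of `SL₂(ℤ)`. -/
def mulRight (M : FixedDetMatrix (Fin 2) ℤ s) (γ : SL(2, ℤ)) : FixedDetMatrix (Fin 2) ℤ s :=
  ⟨M.1 * γ, by rw [Matrix.det_mul, γ.2, mul_one, M.2]⟩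

lemma mulRight_smul (M : FixedDetMatrix (Fin 2) ℤ s) (γ δ : SL(2, ℤ)) :
    mulRight (γ • M) δ = γ • mulRight M δ := by
  exact FixedDetMatrices.ext' _ _ (mul_assoc γ.1 M.1 δ.1)

lemma mulRight_mulRight_inv (M : FixedDetMatrix (Fin 2) ℤ s) (γ : SL(2, ℤ)) :
    mulRight (mulRight M γ) γ⁻¹ = M := by
  apply FixedDetMatrices.ext'
  change M.1 * γ.1 * (γ⁻¹).1 = M.1
  rw [mul_assoc, ← Matrix.SpecialLinearGroup.coe_mul, mul_inv_cancel,
    Matrix.SpecialLinearGroup.coe_one, mul_one]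

variable [NeZero s]

/-- An integral matrix of nonzero determinant, as an element of `GL₂(ℝ)`. -/
def toGL (M : FixedDetMatrix (Fin 2) ℤ s) : GL (Fin 2) ℝ :=
  .mkOfDetNeZero ((Int.castRingHom ℝ).mapMatrix M.1) <| by
    rw [← RingHom.map_det, M.2]
    simpa using NeZero.ne s

lemma det_toGL_pos (M : FixedDetMatrix (Fin 2) ℤ s) : 0 < (toGL M).det.val := by
  have : (toGL M).det.val = s := by
    change ((Int.castRingHom ℝ).mapMatrix M.1).det = s
    rw [← RingHom.map_det, M.2]
    simp
  rw [this]
  exact_mod_cast Nat.pos_of_ne_zero (NeZero.ne s)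

lemma coe_toGL_smul (M : FixedDetMatrix (Fin 2) ℤ s) (τ : ℍ) :
    ((toGL M • τ : ℍ) : ℂ) = (M.1 0 0 * τ + M.1 0 1) / (M.1 1 0 * τ + M.1 1 1) := by
  rw [coe_smul_of_det_pos (det_toGL_pos M)]
  simp [num, denom, toGL]

lemma toGL_smul (γ : SL(2, ℤ)) (M : FixedDetMatrix (Fin 2) ℤ s) :
    toGL (γ • M) = (γ : GL (Fin 2) ℝ) * toGL M := by
  apply Units.ext
  change (Int.castRingHom ℝ).mapMatrix (γ • M).1 = (Int.castRingHom ℝ).mapMatrix γ.1 *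
    (Int.castRingHom ℝ).mapMatrix M.1
  rw [FixedDetMatrices.smul_coe, map_mul]

lemma toGL_mulRight (M : FixedDetMatrix (Fin 2) ℤ s) (γ : SL(2, ℤ)) :
    toGL (mulRight M γ) = toGL M * (γ : GL (Fin 2) ℝ) := by
  apply Units.ext
  change (Int.castRingHom ℝ).mapMatrix (M.1 * γ.1) = (Int.castRingHom ℝ).mapMatrix M.1 *
    (Int.castRingHom ℝ).mapMatrix γ.1
  rw [map_mul]

end FixedDetMatrix

open FixedDetMatrix

/-- The `SL₂(ℤ)`-orbits of integral matrices of determinant `s`. -/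
abbrev DetOrbit (s : ℕ) := MulAction.orbitRel.Quotient SL(2, ℤ) (FixedDetMatrix (Fin 2) ℤ s)

namespace DetOrbit

variable {s : ℕ} [NeZero s]

lemma exists_reps (x : DetOrbit s) : ∃ T ∈ FixedDetMatrices.reps s, x = Quotient.mk'' T := by
  induction x using Quotient.inductionOn' with | h M =>
  have hs : (s : ℤ) ≠ 0 := by exact_mod_cast NeZero.ne s
  refine FixedDetMatrices.induction_on (A := M)
    (C := fun M => ∃ T ∈ FixedDetMatrices.reps s, (Quotient.mk'' M : DetOrbit s) = Quotient.mk'' T)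
    hs (fun A h1 h2 h3 h4 => ⟨A, ⟨h1, h2, h3, h4⟩, rfl⟩) ?_ ?_ <;>
  · rintro B ⟨T, hT, h⟩
    exact ⟨T, hT, .trans (Quotient.sound' ⟨_, rfl⟩) h⟩

instance : Finite (DetOrbit s) :=
  Finite.of_surjective (fun T : FixedDetMatrices.reps s => (Quotient.mk'' T.1 : DetOrbit s))
    fun x => let ⟨T, hT, h⟩ := exists_reps x; ⟨⟨T, hT⟩, h.symm⟩

instance : Fintype (DetOrbit s) := Fintype.ofFinite _

/-- The value of `j` at `M • τ`, which depends only on the orbit of `M`. -/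
def jValue (x : DetOrbit s) (τ : ℍ) : ℂ :=
  Quotient.liftOn' x (fun M => jInvariant (toGL M • τ)) <| by
    rintro _ M ⟨γ, rfl⟩
    simp only
    rw [toGL_smul, mul_smul]
    exact jInvariant_smul γ _

lemma jValue_mk (M : FixedDetMatrix (Fin 2) ℤ s) (τ : ℍ) :
    jValue (Quotient.mk'' M) τ = jInvariant (toGL M • τ) := rfl

/-- Right multiplication permutes the orbits. -/
def mulRightEquiv (γ : SL(2, ℤ)) : DetOrbit s ≃ DetOrbit s where
  toFun := Quotient.map' (mulRight · γ) <| by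
    rintro _ M ⟨δ, rfl⟩
    exact ⟨δ, (mulRight_smul M δ γ).symm⟩
  invFun := Quotient.map' (mulRight · γ⁻¹) <| by
    rintro _ M ⟨δ, rfl⟩
    exact ⟨δ, (mulRight_smul M δ γ⁻¹).symm⟩
  left_inv x := by
    induction x using Quotient.inductionOn' with | h M =>
    exact congrArg Quotient.mk'' (mulRight_mulRight_inv M γ)
  right_inv x := by
    induction x using Quotient.inductionOn' with | h M =>
    refine congrArg Quotient.mk'' ?_
    simpa using mulRight_mulRight_inv M γ⁻¹

lemma jValue_mulRightEquiv (γ : SL(2, ℤ)) (x : DetOrbit s) (τ : ℍ) :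
    jValue (mulRightEquiv γ x) τ = jValue x (γ • τ) := by
  induction x using Quotient.inductionOn' with | h M =>
  change jInvariant (toGL (mulRight M γ) • τ) = jInvariant (toGL M • γ • τ)
  rw [toGL_mulRight, mul_smul]
  rfl

lemma mdifferentiable_jValue (x : DetOrbit s) : MDiff (jValue x) := by
  induction x using Quotient.inductionOn' with | h M =>
  exact mdifferentiable_jInvariant.comp (mdifferentiable_smul (det_toGL_pos M))

end DetOrbit

lemma qParam_one_eq_pow {s : ℕ} (hs : s ≠ 0) (z : ℂ) : 𝕢 1 z = 𝕢 s z ^ s := by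
  have hsC : (s : ℂ) ≠ 0 := by exact_mod_cast hs
  rw [qParam, qParam, ← Complex.exp_nat_mul]
  congr 1
  push_cast
  field_simp

namespace DetOrbit

variable {s : ℕ} [NeZero s]

/-- In terms of `q = exp (2πiτ / s)`, a triangular matrix acts as `q ↦ ζ q ^ (a ^ 2)`. -/
lemma exists_qParam_toGL_smul {T : FixedDetMatrix (Fin 2) ℤ s}
    (hT : T ∈ FixedDetMatrices.reps s) :
    ∃ (ζ : ℂ) (a : ℕ), a ≠ 0 ∧ ζ ^ s = 1 ∧
      ∀ τ : ℍ, 𝕢 1 (toGL T • τ : ℍ) = ζ * 𝕢 s τ ^ (a ^ 2) := by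
  obtain ⟨h10, h00, -, -⟩ := hT
  have hs : (s : ℤ) ≠ 0 := by exact_mod_cast NeZero.ne s
  obtain ⟨a, ha⟩ : ∃ a : ℕ, T.1 0 0 = a := ⟨_, (Int.toNat_of_nonneg h00.le).symm⟩
  have hdet : (a : ℤ) * T.1 1 1 = s := by
    simpa [Matrix.det_fin_two, h10, ha] using T.2
  set b := T.1 0 1 with hb
  set d := T.1 1 1 with hd'
  have hd : (d : ℂ) ≠ 0 := by
    rintro h
    rw [Int.cast_eq_zero.mp h, mul_zero] at hdet
    exact hs hdet.symm
  have hsC : (s : ℂ) ≠ 0 := by exact_mod_cast NeZero.ne s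
  have hdetC : (a : ℂ) * d = s := by exact_mod_cast hdet
  refine ⟨Complex.exp (2 * Real.pi * Complex.I * b / d), a, by rintro rfl; simp [ha] at h00, ?_, ?_⟩
  · rw [← Complex.exp_nat_mul, Complex.exp_eq_one_iff]
    refine ⟨a * b, ?_⟩
    push_cast
    rw [← hdetC]
    field_simp
  · intro τ
    rw [coe_toGL_smul, h10, ha, ← hb, ← hd', qParam, qParam, ← Complex.exp_nat_mul, ← Complex.exp_add]
    congr 1
    push_cast
    rw [← hdetC]
    have : (a : ℂ) ≠ 0 := fun h => hsC (by rw [← hdetC, h, zero_mul])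
    rw [zero_mul, zero_add]
    field_simp
    ring

lemma exists_hasQExp_sub (hs : ¬ IsSquare s) (x : DetOrbit s) :
    ∃ (r : ℕ) (u : ℂ), u ^ (2 * s) = 1 ∧
      HasQExp s r u (fun τ => jInvariant τ - jValue x τ) := by
  obtain ⟨T, hT, rfl⟩ := exists_reps x
  obtain ⟨ζ, a, ha, hζ, hq⟩ := exists_qParam_toGL_smul hT
  have hs0 : s ≠ 0 := NeZero.ne s
  have hζ0 : ζ ≠ 0 := by
    rintro rfl
    simp [hs0] at hζ
  have hζi : IsIntegral ℤ ζ := .of_pow (Nat.pos_of_ne_zero hs0) (hζ ▸ isIntegral_one)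
  have hζi' : IsIntegral ℤ ζ⁻¹ :=
    .of_pow (Nat.pos_of_ne_zero hs0) (by rw [inv_pow, hζ, inv_one]; exact isIntegral_one)
  have h1 := hasQExp_jInvariant.comp (s := s) hζ0 hζi (by simpa using hζi') (pow_ne_zero 2 ha) hq
  have h2 := hasQExp_jInvariant.comp (s := s) (φ := id) one_ne_zero isIntegral_one
    (by simpa using isIntegral_one) hs0 (fun τ => by
      rw [one_mul, id, qParam_one_eq_pow hs0])
  have hne : (s : ℤ) * 1 ≠ ((a ^ 2 : ℕ) : ℤ) * 1 := by
    rw [mul_one, mul_one, Ne, Nat.cast_inj]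
    exact fun h => hs ⟨a, by rw [h, sq]⟩
  have h3 := h2.sub_of_ne h1 hne
  simp only [mul_one, ← Nat.cast_max, zpow_neg_one] at h3
  refine ⟨_, _, ?_, h3⟩
  split_ifs
  · simp
  · rw [pow_mul, neg_sq, ← pow_mul, mul_comm, pow_mul, inv_pow, hζ, inv_one,
      one_pow]

/-- `∏ (j(τ) - j(M • τ))` over the orbits of integral matrices `M` of determinant `s`. -/
def jDiffProd (s : ℕ) [NeZero s] (τ : ℍ) : ℂ := ∏ x : DetOrbit s, (jInvariant τ - jValue x τ)

lemma jDiffProd_smul (γ : SL(2, ℤ)) (τ : ℍ) : jDiffProd s (γ • τ) = jDiffProd s τ := by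
  refine Fintype.prod_equiv (mulRightEquiv γ) _ _ fun x => ?_
  rw [jInvariant_smul, jValue_mulRightEquiv]

lemma jDiffProd_eq_zero {M : FixedDetMatrix (Fin 2) ℤ s} {τ : ℍ} (h : toGL M • τ = τ) :
    jDiffProd s τ = 0 := by
  refine Finset.prod_eq_zero (Finset.mem_univ (Quotient.mk'' M)) ?_
  rw [jValue_mk, h, sub_self]

lemma mdifferentiable_jDiffProd : MDiff (jDiffProd s) := by
  have h := MDifferentiable.prod (t := Finset.univ)
    (f := fun (x : DetOrbit s) (τ : ℍ) => jInvariant τ - jValue x τ)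
    fun x _ => mdifferentiable_jInvariant.sub (mdifferentiable_jValue x)
  convert! h using 1
  ext τ
  simp [jDiffProd]

lemma exists_hasQExp_mul (hs : ¬ IsSquare s) :
    ∃ N : ℕ, HasQExp s 0 1 (fun τ => jDiffProd s τ ^ (2 * s) * discriminant τ ^ N) := by
  choose r u hu h using exists_hasQExp_sub hs
  have hs0 : s ≠ 0 := NeZero.ne s
  have h1 := (HasQExp.prod Finset.univ fun x _ => h x).pow (2 * s)
  have h2 := (hasQExp_discriminant.comp (s := s) (φ := id) one_ne_zero isIntegral_one
    (by simpa using isIntegral_one) hs0 (fun τ => by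
      rw [one_mul, id, qParam_one_eq_pow hs0])).pow (2 * ∑ x, r x)
  refine ⟨2 * ∑ x, r x, ?_⟩
  convert! h1.mul h2 using 1
  · push_cast
    ring
  · simp [← Finset.prod_pow, hu]

end DetOrbit

lemma HasQExp.isBoundedAtImInfty {s : ℕ} (hs : s ≠ 0) {u : ℂ} {f : ℍ → ℂ}
    (hf : HasQExp s 0 u f) : IsBoundedAtImInfty f := by
  obtain ⟨p, -, -, h⟩ := hf
  exact isBoundedAtImInfty_of_hasSum_qExpansion (h := s)
    (by exact_mod_cast Nat.pos_of_ne_zero hs) (fun τ => by simpa using h τ)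

lemma HasQExp.qExpansion_mem {s : ℕ} (hs : s ≠ 0) {u : ℂ} {k : ℤ} {F : ModularForm 𝒮ℒ k}
    (hF : HasQExp s 0 u F) :
    qExpansion 1 F ∈ integralPowerSeries ∧ (qExpansion 1 F).coeff 0 = u := by
  obtain ⟨p, hp, rfl, h⟩ := hF
  have hs' : (0 : ℝ) < s := by exact_mod_cast Nat.pos_of_ne_zero hs
  have hper : (s : ℝ) ∈ (𝒮ℒ : Subgroup (GL (Fin 2) ℝ)).strictPeriods := by
    simpa using nsmul_mem one_mem_strictPeriods_SL s
  have h1 := ModularFormClass.qExpansion_coeff_unique (c := fun n => p.coeff n) (f := F) hs' hper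
    (fun τ => by simpa using h τ)
  have h2 := ModularFormClass.qExpansion_coeff_unique (f := F)
    (c := fun n => ((qExpansion 1 F).expand s hs).coeff n) hs' hper fun τ => by
    have h3 := ModularForm.hasSum_qExpansion (f := F) one_pos one_mem_strictPeriods_SL τ
    rw [qParam_one_eq_pow hs] at h3
    refine ((mul_right_injective₀ hs).hasSum_iff fun n hn => ?_).mp (h3.congr_fun fun k => ?_)
    · rw [PowerSeries.coeff_expand, if_neg, zero_smul]
      rintro ⟨k, rfl⟩
      exact hn ⟨k, rfl⟩
    · rw [Function.comp_apply, PowerSeries.coeff_expand_mul, pow_mul, smul_eq_mul]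
  have h4 : ∀ n, (qExpansion 1 F).coeff n = p.coeff (s * n) := fun n => by
    rw [h1, ← h2, PowerSeries.coeff_expand_mul]
  refine ⟨?_, by simp [h4]⟩
  rw [mem_integralPowerSeries_iff] at hp ⊢
  exact fun n => h4 n ▸ hp _

namespace DetOrbit

variable {s : ℕ} [NeZero s]

lemma exists_modularForm (hs : ¬ IsSquare s) :
    ∃ (N : ℕ) (F : ModularForm 𝒮ℒ (12 * N)), HasQExp s 0 1 F ∧
      ∀ τ, F τ = jDiffProd s τ ^ (2 * s) * discriminant τ ^ N := by
  obtain ⟨N, hN⟩ := exists_hasQExp_mul hs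
  set f : ℍ → ℂ := fun τ => jDiffProd s τ ^ (2 * s) * discriminant τ ^ N with hf
  have hslash : ∀ γ : SL(2, ℤ), f ∣[(12 * N : ℤ)] γ = f := fun γ => by
    ext τ
    have h0 : denom γ τ ≠ 0 := denom_ne_zero _ τ
    rw [SL_slash_apply, hf]
    simp only [jDiffProd_smul, discriminant_smul]
    rw [mul_pow, zpow_neg, zpow_mul, zpow_natCast]
    field_simp
  refine ⟨N, { toFun := f, slash_action_eq' := ?_, holo' := ?_, bdd_at_cusps' := ?_ }, hN,
    fun τ => rfl⟩
  · rintro _ ⟨γ, rfl⟩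
    exact hslash γ
  · exact (mdifferentiable_jDiffProd.pow _).mul (CuspForm.discriminant.holo'.pow _)
  · intro c hc
    rw [Subgroup.IsArithmetic.isCusp_iff_isCusp_SL2Z] at hc
    rw [OnePoint.isBoundedAt_iff_forall_SL2Z hc]
    intro γ _
    rw [hslash γ]
    exact hN.isBoundedAtImInfty (NeZero.ne s)

/-- A singular value of `j` is an algebraic integer. -/
theorem isIntegral_jInvariant (hs : ¬ IsSquare s) {M : FixedDetMatrix (Fin 2) ℤ s} {τ : ℍ}
    (h : toGL M • τ = τ) : IsIntegral ℤ (jInvariant τ) := by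
  obtain ⟨N, F, hF, hFτ⟩ := exists_modularForm hs
  obtain ⟨hint, h1⟩ := hF.qExpansion_mem (NeZero.ne s)
  obtain ⟨P, hdeg, hlead, hP⟩ := exists_polynomial_jInvariant N rfl F hint
  have h2 := hP τ
  rw [hFτ, jDiffProd_eq_zero h, zero_pow (by simpa using NeZero.ne s), zero_mul, eq_comm,
    mul_eq_zero_iff_right (pow_ne_zero _ (discriminant_ne_zero τ))] at h2
  have hmonic : P.Monic := monic_of_natDegree_le_of_coeff_eq_one N hdeg <| by
    rw [h1] at hlead
    exact_mod_cast hlead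
  have : IsIntegral (integralClosure ℤ ℂ) (jInvariant τ) := ⟨P, hmonic, h2⟩
  exact isIntegral_trans _ this

end DetOrbit

lemma tsum_ne_zero_zpow_eq {k : ℕ} (hk : 3 ≤ k) (τ : ℍ) :
    ∑' w : {v : ℤ × ℤ // v ≠ 0}, ((w.1.1 : ℂ) * τ + w.1.2) ^ (-k : ℤ) =
      2 * riemannZeta k * E hk τ := by
  have h1 := tsum_eisSummand_eq_riemannZeta_mul_eisensteinSeries hk τ
  rw [← (finTwoArrowEquiv ℤ).symm.tsum_eq] at h1
  rw [show E hk τ = (1 / 2 : ℂ) • eisensteinSeriesSIF (N := 1) 0 k τ from rfl,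
    eisensteinSeriesSIF_apply 0 k τ]
  have h2 := tsum_subtype_eq_of_support_subset (s := {v : ℤ × ℤ | v ≠ 0})
    (f := fun v => eisSummand k ((finTwoArrowEquiv ℤ).symm v) τ) fun v hv h0 => hv <| by
      have : k ≠ 0 := by lia
      simp_all [eisSummand]
  calc _ = _ := h2
    _ = _ := h1
    _ = _ := by
      rw [smul_eq_mul]
      ring

lemma riemannZeta_six : riemannZeta 6 = (Real.pi : ℂ) ^ 6 / 945 := by
  have h := riemannZeta_two_mul_nat (k := 3) (by norm_num)
  norm_num at h
  rw [h, show _root_.bernoulli 6 = 1 / 42 by decide +kernel]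
  norm_num [Nat.factorial]
  ring

lemma jC_coe (τ : ℍ) : jC τ = jInvariant τ := by
  have h2 : g2C τ = 4 * Real.pi ^ 4 / 3 * E₄ τ := by
    have h := tsum_ne_zero_zpow_eq (k := 4) (by norm_num) τ
    push_cast at h
    rw [g2C, h, riemannZeta_four]
    ring
  have h3 : g3C τ = 8 * Real.pi ^ 6 / 27 * E₆ τ := by
    have h := tsum_ne_zero_zpow_eq (k := 6) (by norm_num) τ
    push_cast at h
    rw [g3C, h, riemannZeta_six]
    ring
  have hpi : (Real.pi : ℂ) ≠ 0 := by exact_mod_cast Real.pi_ne_zero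
  have hΔ := discriminant_ne_zero τ
  rw [jC, discC, h2, h3, jInvariant]
  have hd : (4 * Real.pi ^ 4 / 3 * E₄ τ) ^ 3 - 27 * (8 * Real.pi ^ 6 / 27 * E₆ τ) ^ 2 =
      1728 * (4 * Real.pi ^ 4 / 3 : ℂ) ^ 3 * discriminant τ := by
    rw [discriminant_eq_E₄_cube_sub_E₆_sq]
    ring
  rw [hd]
  field_simp

/-- Clearing denominators in the minimal polynomial of a quadratic irrationality. -/
lemma exists_int_quadratic {α : ℂ} (hdeg : Module.finrank ℚ ℚ⟮α⟯ = 2) :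
    ∃ a b c : ℤ, a ≠ 0 ∧ a * α ^ 2 + b * α + c = 0 := by
  have hint : IsIntegral ℚ α := by
    have : FiniteDimensional ℚ ℚ⟮α⟯ := .of_finrank_pos (by lia)
    exact (IsIntegral.of_finite ℚ (AdjoinSimple.gen ℚ α)).map ℚ⟮α⟯.val
  have hdeg2 : (minpoly ℚ α).natDegree = 2 := by
    rw [← IntermediateField.adjoin.finrank hint, hdeg]
  have h0 := minpoly.aeval ℚ α
  rw [aeval_eq_sum_range, hdeg2] at h0
  have hm : (minpoly ℚ α).coeff 2 = 1 := by
    rw [← hdeg2]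
    exact minpoly.monic hint
  set p := (minpoly ℚ α).coeff 0 with hp
  set q := (minpoly ℚ α).coeff 1 with hq
  refine ⟨p.den * q.den, p.den * q.num, p.num * q.den,
    mul_ne_zero (by exact_mod_cast p.den_ne_zero) (by exact_mod_cast q.den_ne_zero), ?_⟩
  have hpd : (p.den : ℂ) ≠ 0 := by exact_mod_cast p.den_ne_zero
  have hqd : (q.den : ℂ) ≠ 0 := by exact_mod_cast q.den_ne_zero
  simp [Finset.sum_range_succ, hm, ← hp, ← hq, Algebra.smul_def, Rat.cast_def] at h0
  field_simp at h0
  push_cast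
  linear_combination h0

lemma exists_toGL_smul_eq_self (τ : ℍ) {a b c : ℤ} (ha : a ≠ 0)
    (h : a * (τ : ℂ) ^ 2 + b * τ + c = 0) :
    ∃ (s : ℕ) (_ : NeZero s) (M : FixedDetMatrix (Fin 2) ℤ s),
      ¬ IsSquare s ∧ toGL M • τ = τ := by
  have hmpos : 0 < 4 * a * c - b ^ 2 := by
    have hre := congrArg Complex.re h
    have him := congrArg Complex.im h
    simp only [sq, add_re, mul_re, add_im, mul_im, intCast_re, intCast_im, zero_mul, sub_zero,
      add_zero, zero_re, zero_im] at hre him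
    have hτ : (0 : ℝ) < (τ : ℂ).im := τ.im_pos
    set x := (τ : ℂ).re
    set y := (τ : ℂ).im
    have haR : (a : ℝ) ≠ 0 := by exact_mod_cast ha
    have h1 : 2 * a * x + b = 0 := by
      refine (mul_eq_zero_iff_right hτ.ne').mp ?_
      linear_combination him
    have h2 : (4 * a * c - b ^ 2 : ℝ) = (2 * a * y) ^ 2 := by
      linear_combination 4 * a * hre - (2 * a * x + b) * h1
    have h3 : (0 : ℝ) < 4 * a * c - b ^ 2 := by
      rw [h2]
      positivity
    exact_mod_cast h3
  obtain ⟨m, hm⟩ := Int.eq_ofNat_of_zero_le hmpos.le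
  have hm0 : 0 < m := by lia
  have hs0 : m ^ 2 + m ≠ 0 := by positivity
  have : NeZero (m ^ 2 + m) := ⟨hs0⟩
  obtain ⟨M, hM⟩ : ∃ M : FixedDetMatrix (Fin 2) ℤ (m ^ 2 + m : ℕ),
      M.1 = !![(m : ℤ) - b, -2 * c; 2 * a, m + b] := by
    refine ⟨⟨_, ?_⟩, rfl⟩
    rw [Matrix.det_fin_two_of]
    push_cast
    linear_combination hm
  refine ⟨m ^ 2 + m, this, M, ?_, ?_⟩
  · rintro ⟨k, hk⟩
    rcases le_or_gt k m with h | h <;> nlinarith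
  · apply UpperHalfPlane.ext
    rw [coe_toGL_smul, hM]
    have haC : (2 * a : ℝ) ≠ 0 := by exact_mod_cast mul_ne_zero two_ne_zero ha
    have hden : ((2 * a : ℤ) : ℂ) * τ + ((m + b : ℤ) : ℂ) ≠ 0 := by
      intro h0
      have := congrArg Complex.im h0
      simp [ha, τ.im_pos.ne'] at this
    simp only [Matrix.of_apply, Matrix.cons_val', Matrix.cons_val_zero, Matrix.cons_val_one,
      Matrix.cons_val_fin_one]
    rw [div_eq_iff hden]
    push_cast
    linear_combination (-2) * h

end SingularValues

/-- If α lies in the upper half-plane and is imaginary quadratic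
([ℚ(α):ℚ] = 2), then j(α) is an algebraic integer. -/
theorem stmt6 (α : ℂ) (him : 0 < α.im) (hdeg : Module.finrank ℚ ℚ⟮α⟯ = 2) :
    IsIntegral ℤ (jC α) := by
  obtain ⟨a, b, c, ha, h⟩ := exists_int_quadratic hdeg
  obtain ⟨s, _, M, hs, hM⟩ := exists_toGL_smul_eq_self ⟨α, him⟩ ha h
  rw [show jC α = _ from jC_coe ⟨α, him⟩]
  exact DetOrbit.isIntegral_jInvariant hs hM

end
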